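/- arXiv:2207.12216 — 2 statements merged into one kernel-verified Lean document; each statement's English description precedes it below -/
import Mathlib

section
/- Let ψ be analytic on D and φ an automorphism of D. The weighted composition operator W_{ψ,φ} f = ψ · (f ∘ φ) is bounded on S^2 if and only if ψ ∈ S^2. -/
open Metric Filter

noncomputable def taylorCoeff (f : ℂ → ℂ) (n : ℕ) : ℂ :=
  iteratedDeriv n f 0 / n.factorial

/-- Membership in `S²`: `f` is analytic on the open unit disk, equals its Taylor
series there, and its coefficients satisfy `Σ n² |a n|² < ∞`. -/
def MemS2 (f : ℂ → ℂ) : Prop :=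
  AnalyticOn ℂ f (ball (0:ℂ) 1) ∧
  (∀ z ∈ ball (0:ℂ) 1, HasSum (fun n : ℕ => taylorCoeff f n * z ^ n) (f z)) ∧
  Summable (fun n : ℕ => ((n : ℝ))^2 * ‖taylorCoeff f n‖^2)

/-- The square of the `S²` norm: `|a₀|² + Σ_{n≥1} n² |aₙ|²`. -/
noncomputable def s2NormSq (f : ℂ → ℂ) : ℝ :=
  ‖taylorCoeff f 0‖^2 + ∑' n : ℕ, ((n : ℝ) + 1)^2 * ‖taylorCoeff f (n+1)‖^2

noncomputable def s2Norm (f : ℂ → ℂ) : ℝ := Real.sqrt (s2NormSq f)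

/-- The square of the `H²` norm, in terms of Taylor coefficients. -/
noncomputable def h2NormSq (f : ℂ → ℂ) : ℝ := ∑' n : ℕ, ‖taylorCoeff f n‖^2

noncomputable def h2Norm (f : ℂ → ℂ) : ℝ := Real.sqrt (h2NormSq f)

/-- An operator on functions is bounded on `S²`. -/
def BoundedOpS2 (T : (ℂ → ℂ) → (ℂ → ℂ)) : Prop :=
  (∀ f, MemS2 f → MemS2 (T f)) ∧
  ∃ C : ℝ, ∀ f, MemS2 f → s2Norm (T f) ≤ C * s2Norm f

/-- The operator norm of an operator on `S²`. -/
noncomputable def opNormS2 (T : (ℂ → ℂ) → (ℂ → ℂ)) : ℝ :=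
  sInf {C : ℝ | 0 ≤ C ∧ ∀ f, MemS2 f → s2Norm (T f) ≤ C * s2Norm f}

/-- An (analytic) automorphism of the unit disk. -/
def IsDiskAut (φ : ℂ → ℂ) : Prop :=
  AnalyticOn ℂ φ (ball (0:ℂ) 1) ∧ Set.BijOn φ (ball (0:ℂ) 1) (ball (0:ℂ) 1)

lemma S2aux_hasSum_congr {f g : ℕ → ℂ} {a : ℂ} (h : ∀ n, f n = g n) (hf : HasSum f a) :
    HasSum g a := by
  rwa [funext h] at hf

lemma S2aux_taylor_hasSum {F : ℂ → ℂ} (hF : DifferentiableOn ℂ F (ball (0:ℂ) 1)) {z : ℂ}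
    (hz : z ∈ ball (0:ℂ) 1) : HasSum (fun n : ℕ => taylorCoeff F n * z ^ n) (F z) := by
  have h := Complex.hasSum_taylorSeries_on_eball (c := 0) (r := 1) (f := F)
    (by rwa [show (1:ENNReal) = ENNReal.ofReal 1 by simp, Metric.eball_ofReal])
    (by rwa [show (1:ENNReal) = ENNReal.ofReal 1 by simp, Metric.eball_ofReal])
  refine S2aux_hasSum_congr (fun n => ?_) h
  simp only [taylorCoeff, sub_zero, smul_eq_mul]
  ring

lemma S2aux_coeff {F : ℂ → ℂ} (hF : DifferentiableOn ℂ F (ball (0:ℂ) 1)) {r : ℝ}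
    (h0 : 0 < r) (h1 : r < 1) (n : ℕ) :
    Real.circleAverage (fun z => (starRingEnd ℂ z) ^ n * F z) 0 r
      = (r:ℂ) ^ (2 * n) * taylorCoeff F n := by
  have h := DifferentiableOn.circleIntegral_one_div_sub_center_pow_smul (c := 0) h0 n
    (hF.mono (closedBall_subset_ball h1))
  have e : Real.circleAverage (fun z => (starRingEnd ℂ z) ^ n * F z) 0 r
      = Real.circleAverage (fun z => (r:ℂ) ^ (2 * n) • ((1 / z ^ n) * F z)) 0 r := by
    apply Real.circleAverage_congr_sphere
    intro z hz
    have hz' : ‖z‖ = r := by simpa [abs_of_pos h0] using hz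
    have hz0 : z ≠ 0 := by
      intro h; rw [h] at hz'; simp at hz'; linarith
    have : (starRingEnd ℂ z) * z = (r:ℂ)^2 := by
      rw [← Complex.normSq_eq_conj_mul_self, Complex.normSq_eq_norm_sq, hz']; push_cast; rfl
    simp only [smul_eq_mul]
    rw [pow_mul, ← this, mul_pow]
    field_simp
  rw [e, Real.circleAverage_fun_smul, Real.circleAverage_eq_circleIntegral h0.ne']
  have e2 : (∮ z in C(0, r), (z - 0)⁻¹ • (1 / z ^ n * F z)) =
      ∮ z in C(0, r), (1 / (z - 0) ^ (n + 1)) • F z := by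
    congr 1; ext z; simp only [sub_zero, smul_eq_mul, pow_succ, one_div, mul_inv]; ring
  rw [e2, h, taylorCoeff]
  simp only [smul_eq_mul]
  have := Complex.two_pi_I_ne_zero
  field_simp

lemma S2aux_circleInt {F : ℂ → ℝ} (hF : ContinuousOn F (ball (0:ℂ) 1)) {r : ℝ}
    (h0 : 0 < r) (h1 : r < 1) : CircleIntegrable F 0 r := by
  apply ContinuousOn.circleIntegrable h0.le
  apply hF.mono
  intro z hz
  simp at hz ⊢
  linarith

lemma S2aux_parseval {F : ℂ → ℂ} (hF : DifferentiableOn ℂ F (ball (0:ℂ) 1)) {r : ℝ}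
    (h0 : 0 < r) (h1 : r < 1) :
    HasSum (fun n : ℕ => ‖taylorCoeff F n‖ ^ 2 * r ^ (2 * n))
      (Real.circleAverage (fun z => ‖F z‖ ^ 2) 0 r) := by
  obtain ⟨M, hM⟩ := (isCompact_closedBall (0:ℂ) r).exists_bound_of_continuousOn
    (hF.continuousOn.mono (closedBall_subset_ball h1))
  have hmem : ∀ θ, circleMap 0 r θ ∈ ball (0:ℂ) 1 := fun θ => by
    simp [abs_of_pos h0, h1]
  have hcont : Continuous (fun θ => F (circleMap 0 r θ)) :=
    hF.continuousOn.comp_continuous (continuous_circleMap 0 r) hmem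
  have hs0 : Summable (fun n : ℕ => ‖taylorCoeff F n‖ * r ^ n) := by
    have := (S2aux_taylor_hasSum hF (z := r) (by simp [abs_of_pos h0, h1])).summable.norm
    simpa [abs_of_pos h0] using this
  have key := intervalIntegral.hasSum_integral_of_dominated_convergence
    (μ := MeasureTheory.volume) (a := 0) (b := 2 * Real.pi)
    (F := fun (n : ℕ) θ => starRingEnd ℂ (taylorCoeff F n) *
      ((starRingEnd ℂ (circleMap 0 r θ)) ^ n * F (circleMap 0 r θ)))
    (f := fun θ => ((‖F (circleMap 0 r θ)‖ ^ 2 : ℝ) : ℂ))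
    (bound := fun n _ => ‖taylorCoeff F n‖ * r ^ n * M)
    (fun n => by
      apply Continuous.aestronglyMeasurable
      have := continuous_circleMap 0 r
      exact continuous_const.mul (((Complex.continuous_conj.comp this).pow n).mul hcont))
    (fun n => by
      filter_upwards with θ _
      simp only [norm_mul, RCLike.norm_conj, norm_pow, norm_circleMap_zero, abs_of_pos h0]
      rw [mul_assoc]
      gcongr
      exact hM _ (by simp [abs_of_pos h0]))
    (by filter_upwards with θ _ using hs0.mul_right M)
    (by simp)
    (by
      filter_upwards with θ _
      have h := (S2aux_taylor_hasSum hF (hmem θ))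
      have h2 := (Complex.hasSum_conj'.mpr h).mul_right (F (circleMap 0 r θ))
      rw [← Complex.normSq_eq_conj_mul_self, Complex.normSq_eq_norm_sq] at h2
      refine S2aux_hasSum_congr (fun n => ?_) h2
      simp only [map_mul, map_pow]; ring)
  have key2 := key.const_smul ((2 * Real.pi)⁻¹ : ℝ)
  rw [← Complex.hasSum_ofReal]
  have e1 : (((Real.circleAverage (fun z => ‖F z‖ ^ 2) 0 r : ℝ)) : ℂ) = (2 * Real.pi)⁻¹ •
      ∫ (t : ℝ) in 0..2 * Real.pi, ((‖F (circleMap 0 r t)‖ ^ 2 : ℝ) : ℂ) := by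
    rw [intervalIntegral.integral_ofReal, Real.circleAverage_def]
    simp
  rw [e1]
  refine S2aux_hasSum_congr (fun n => ?_) key2
  have h := S2aux_coeff hF h0 h1 n
  rw [Real.circleAverage_def] at h
  rw [intervalIntegral.integral_const_mul, ← mul_smul_comm, h]
  have := Complex.normSq_eq_conj_mul_self (z := taylorCoeff F n)
  rw [Complex.normSq_eq_norm_sq] at this
  push_cast at this ⊢
  rw [this]; ring

/-- If the means are bounded, the coefficients are square summable. -/
lemma S2aux_summable_of_means {F : ℂ → ℂ} (hF : DifferentiableOn ℂ F (ball (0:ℂ) 1)) {K : ℝ}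
    (h : ∀ r : ℝ, 0 < r → r < 1 → Real.circleAverage (fun z => ‖F z‖ ^ 2) 0 r ≤ K) :
    Summable (fun n : ℕ => ‖taylorCoeff F n‖ ^ 2) ∧ ∑' n : ℕ, ‖taylorCoeff F n‖ ^ 2 ≤ K := by
  have hb : ∀ s : Finset ℕ, ∑ n ∈ s, ‖taylorCoeff F n‖ ^ 2 ≤ K := by
    intro s
    have ht : Tendsto (fun r : ℝ => ∑ n ∈ s, ‖taylorCoeff F n‖ ^ 2 * r ^ (2 * n))
        (nhdsWithin 1 (Set.Iio 1)) (nhds (∑ n ∈ s, ‖taylorCoeff F n‖ ^ 2 * 1 ^ (2 * n))) := by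
      apply Tendsto.mono_left _ nhdsWithin_le_nhds
      apply Continuous.tendsto
      fun_prop
    simp only [one_pow, mul_one] at ht
    apply le_of_tendsto ht
    filter_upwards [Ioo_mem_nhdsLT (show (0:ℝ) < 1 by norm_num)] with r hr
    have hp := S2aux_parseval hF hr.1 hr.2
    exact (sum_le_hasSum s (fun n _ => by have := hr.1; positivity) hp).trans (h r hr.1 hr.2)
  have hs : Summable (fun n : ℕ => ‖taylorCoeff F n‖ ^ 2) :=
    summable_of_sum_le (fun n => by positivity) hb
  exact ⟨hs, hs.tsum_le_of_sum_le hb⟩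

lemma S2aux_means_le {F : ℂ → ℂ} (hF : DifferentiableOn ℂ F (ball (0:ℂ) 1))
    (hs : Summable (fun n : ℕ => ‖taylorCoeff F n‖ ^ 2)) {r : ℝ} (h0 : 0 < r) (h1 : r < 1) :
    Real.circleAverage (fun z => ‖F z‖ ^ 2) 0 r ≤ ∑' n : ℕ, ‖taylorCoeff F n‖ ^ 2 := by
  have hp := S2aux_parseval hF h0 h1
  rw [← hp.tsum_eq]
  apply hp.summable.tsum_le_tsum _ hs
  intro n
  apply mul_le_of_le_one_right (by positivity)
  exact pow_le_one₀ h0.le h1.le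

/-- Littlewood subordination on `H²`, in terms of means. -/
lemma S2aux_littlewood {g φ : ℂ → ℂ} (hg : DifferentiableOn ℂ g (ball (0:ℂ) 1))
    (hφ : DifferentiableOn ℂ φ (ball (0:ℂ) 1)) (hm : Set.MapsTo φ (ball (0:ℂ) 1) (ball (0:ℂ) 1))
    (hs : Summable (fun n : ℕ => ‖taylorCoeff g n‖ ^ 2)) {r : ℝ} (h0 : 0 < r) (h1 : r < 1) :
    Real.circleAverage (fun z => ‖g (φ z)‖ ^ 2) 0 r ≤
      (4 / (1 - ‖φ 0‖)) * ∑' n : ℕ, ‖taylorCoeff g n‖ ^ 2 := by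
  have ha : ‖φ 0‖ < 1 := by simpa using hm (show (0:ℂ) ∈ ball (0:ℂ) 1 by simp)
  have hsub := closedBall_subset_ball (x := (0:ℂ)) h1
  obtain ⟨z0, hz0, hmax⟩ := (isCompact_closedBall (0:ℂ) r).exists_isMaxOn
    ⟨0, by simp [h0.le]⟩ ((hφ.continuousOn.mono hsub).norm)
  have hz01 : ‖φ z0‖ < 1 := by simpa using hm (hsub hz0)
  obtain ⟨ρ, hρ, hρ1⟩ := exists_between (max_lt hz01 (show (1 + ‖φ 0‖) / 2 < 1 by linarith))
  have hρa : ‖φ z0‖ < ρ := (le_max_left _ _).trans_lt hρ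
  have hρb : (1 + ‖φ 0‖) / 2 < ρ := (le_max_right _ _).trans_lt hρ
  have hρ0 : 0 < ρ := by linarith [norm_nonneg (φ 0)]
  have hmap : ∀ z ∈ closedBall (0:ℂ) r, φ z ∈ ball (0:ℂ) ρ := fun z hz => by
    simpa using (hmax hz).trans_lt hρa
  set G : ℂ → ℝ := fun z => ‖g z‖ ^ 2 with hG
  have hGc : ContinuousOn G (ball (0:ℂ) 1) := hg.continuousOn.norm.pow 2
  have hGi : CircleIntegrable G 0 ρ := S2aux_circleInt hGc hρ0 hρ1
  have hGi' : CircleIntegrable (fun z => (G z : ℂ)) 0 ρ := by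
    apply ContinuousOn.circleIntegrable hρ0.le
    apply Complex.continuous_ofReal.comp_continuousOn
    exact hGc.mono (sphere_subset_closedBall.trans (closedBall_subset_ball hρ1))
  set H : ℂ → ℂ := fun w => Real.circleAverage
    (fun ζ => herglotzRieszKernel 0 w ζ • (G ζ : ℂ)) 0 ρ with hH
  have hHd : DifferentiableOn ℂ H (ball 0 ρ) := fun w hw =>
    (hasDerivAt_circleAverage_herglotzRieszKernel_smul hGi' hw).differentiableAt.differentiableWithinAt
  have hker : ∀ w ∈ ball (0:ℂ) ρ, CircleIntegrable
      ((Complex.re ∘ herglotzRieszKernel 0 w) • G) 0 ρ := by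
    intro w hw
    apply hGi.continuousOn_smul
    exact Complex.continuous_re.comp_continuousOn (continuousOn_herglotzRieszKernel_sphere hw)
  have hHre : ∀ w ∈ ball (0:ℂ) ρ, (H w).re =
      Real.circleAverage ((Complex.re ∘ herglotzRieszKernel 0 w) • G) 0 ρ := fun w hw =>
    re_circleAverage_herglotzRieszKernel_smul hGi hw
  have hkpos : ∀ w ∈ ball (0:ℂ) ρ, ∀ z ∈ sphere (0:ℂ) |ρ|,
      0 ≤ (herglotzRieszKernel 0 w z).re := by
    intro w hw z hz
    rw [abs_of_pos hρ0] at hz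
    refine le_trans ?_ (le_re_herglotzRieszKernel hz hw)
    have : ‖w‖ < ρ := by simpa using hw
    simp only [sub_zero]
    exact div_nonneg (by linarith) (by positivity)
  -- domination
  have hdom : ∀ w ∈ ball (0:ℂ) ρ, ‖g w‖ ^ 2 ≤ (H w).re := by
    intro w hw
    have hdc : DiffContOnCl ℂ (fun z => g z ^ 2) (ball (0:ℂ) ρ) :=
      ((hg.pow 2).mono (closure_ball_subset_closedBall.trans
        (closedBall_subset_ball hρ1))).diffContOnCl
    have hp := hdc.circleAverage_re_herglotzRieszKernel_smul hw
    have : ‖g w‖ ^ 2 = ‖g w ^ 2‖ := by simp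
    rw [this, ← hp, hHre w hw, Real.circleAverage_def, Real.circleAverage_def, norm_smul,
      smul_eq_mul, Real.norm_of_nonneg (by positivity)]
    gcongr
    refine (intervalIntegral.norm_integral_le_integral_norm (by positivity)).trans_eq ?_
    congr 1
    ext θ
    simp only [Pi.smul_apply', Function.comp_apply, norm_smul, norm_pow, hG, smul_eq_mul]
    rw [Real.norm_of_nonneg (hkpos w hw _ (by simp))]
  have hcomp : DiffContOnCl ℂ (fun z => H (φ z)) (ball (0:ℂ) |r|) := by
    rw [abs_of_pos h0]
    apply DifferentiableOn.diffContOnCl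
    apply (hHd.comp (hφ.mono hsub) hmap).mono closure_ball_subset_closedBall
  have hHφc : ContinuousOn (fun z => H (φ z)) (sphere 0 r) :=
    (hHd.comp (hφ.mono hsub) hmap).continuousOn.mono sphere_subset_closedBall
  have hmean := hcomp.circleAverage
  have hre : Real.circleAverage (fun z => (H (φ z)).re) 0 r = (H (φ 0)).re := by
    rw [← hmean]
    exact Complex.reCLM.circleAverage_comp_comm (hHφc.circleIntegrable h0.le)
  have hφ0 : φ 0 ∈ ball (0:ℂ) ρ := hmap 0 (by simp [h0.le])
  calc Real.circleAverage (fun z => ‖g (φ z)‖ ^ 2) 0 r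
      ≤ Real.circleAverage (fun z => (H (φ z)).re) 0 r := by
        apply Real.circleAverage_mono
        · exact S2aux_circleInt ((hg.comp hφ hm).continuousOn.norm.pow 2) h0 h1
        · exact (Complex.continuous_re.comp_continuousOn hHφc).circleIntegrable h0.le
        · intro z hz
          rw [abs_of_pos h0] at hz
          exact hdom _ (hmap z (sphere_subset_closedBall hz))
    _ = (H (φ 0)).re := hre
    _ = Real.circleAverage ((Complex.re ∘ herglotzRieszKernel 0 (φ 0)) • G) 0 ρ := hHre _ hφ0
    _ ≤ Real.circleAverage ((4 / (1 - ‖φ 0‖)) • G) 0 ρ := by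
        apply Real.circleAverage_mono (hker _ hφ0) (hGi.const_smul)
        intro z hz
        rw [abs_of_pos hρ0] at hz
        have h := re_herglotzRieszKernel_le hz hφ0
        simp only [sub_zero] at h
        simp only [Pi.smul_apply', Pi.smul_apply, Function.comp_apply, smul_eq_mul]
        apply mul_le_mul_of_nonneg_right _ (by positivity)
        rw [herglotzRieszKernel_def]
        simp only [sub_zero]
        refine h.trans ?_
        rw [div_le_div_iff₀ (by linarith) (by linarith)]
        nlinarith [norm_nonneg (φ 0)]
    _ = (4 / (1 - ‖φ 0‖)) * Real.circleAverage G 0 ρ := by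
        rw [Real.circleAverage_smul, smul_eq_mul]
    _ ≤ _ := by
        apply mul_le_mul_of_nonneg_left (S2aux_means_le hg hs hρ0 hρ1)
        exact div_nonneg (by norm_num) (by linarith)

lemma S2aux_pick_id (b w : ℂ) :
    ‖1 - (starRingEnd ℂ b) * w‖ ^ 2 - ‖w - b‖ ^ 2 = (1 - ‖b‖ ^ 2) * (1 - ‖w‖ ^ 2) := by
  simp only [← Complex.normSq_eq_norm_sq, Complex.normSq_apply, Complex.sub_re, Complex.sub_im,
    Complex.mul_re, Complex.mul_im, Complex.conj_re, Complex.conj_im, Complex.one_re,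
    Complex.one_im]
  ring

lemma S2aux_den_lb {b w : ℂ} (hw : ‖w‖ < 1) :
    1 - ‖b‖ ≤ ‖1 - (starRingEnd ℂ b) * w‖ := by
  have h1 : ‖(1:ℂ)‖ - ‖(starRingEnd ℂ b) * w‖ ≤ ‖1 - (starRingEnd ℂ b) * w‖ :=
    norm_sub_norm_le _ _
  rw [norm_one, norm_mul, RCLike.norm_conj] at h1
  nlinarith [norm_nonneg b, norm_nonneg w]

lemma S2aux_den_ne {b w : ℂ} (hb : ‖b‖ < 1) (hw : ‖w‖ < 1) :
    1 - (starRingEnd ℂ b) * w ≠ 0 := by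
  have := S2aux_den_lb (b := b) hw
  exact norm_pos_iff.mp (by linarith)

lemma S2aux_pick_lt {b w : ℂ} (hb : ‖b‖ < 1) (hw : ‖w‖ < 1) :
    ‖(w - b) / (1 - (starRingEnd ℂ b) * w)‖ < 1 := by
  have h1 := S2aux_pick_id b w
  have h2 : 0 < ‖1 - (starRingEnd ℂ b) * w‖ := norm_pos_iff.mpr (S2aux_den_ne hb hw)
  rw [norm_div, div_lt_one h2]
  apply lt_of_pow_lt_pow_left₀ 2 h2.le
  have : 0 < (1 - ‖b‖ ^ 2) * (1 - ‖w‖ ^ 2) := by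
    apply mul_pos <;> nlinarith [norm_nonneg b, norm_nonneg w]
  linarith

lemma S2aux_pick_diff {h : ℂ → ℂ} (hd : DifferentiableOn ℂ h (ball (0:ℂ) 1))
    (hm : Set.MapsTo h (ball (0:ℂ) 1) (ball (0:ℂ) 1)) {b : ℂ} (hb : ‖b‖ < 1) :
    DifferentiableOn ℂ (fun w => (h w - b) / (1 - (starRingEnd ℂ b) * h w)) (ball (0:ℂ) 1) := by
  apply DifferentiableOn.div
  · exact hd.sub_const b
  · exact (differentiableOn_const 1).sub (hd.const_mul _)
  · intro w hw
    exact S2aux_den_ne hb (by simpa using hm hw)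

/-- Boundary decay of a self-map. -/
lemma S2aux_decay {h : ℂ → ℂ} (hd : DifferentiableOn ℂ h (ball (0:ℂ) 1))
    (hm : Set.MapsTo h (ball (0:ℂ) 1) (ball (0:ℂ) 1)) {w : ℂ} (hw : ‖w‖ < 1) :
    (1 - ‖h 0‖) ^ 2 * (1 - ‖w‖ ^ 2) ≤ 1 - ‖h w‖ ^ 2 := by
  have hb : ‖h 0‖ < 1 := by simpa using hm (show (0:ℂ) ∈ ball (0:ℂ) 1 by simp)
  have hhw : ‖h w‖ < 1 := by simpa using hm (show w ∈ ball (0:ℂ) 1 by simpa using hw)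
  have hS := Complex.norm_le_norm_of_mapsTo_ball (S2aux_pick_diff hd hm hb)
    (fun z hz => by
      have := S2aux_pick_lt hb (show ‖h z‖ < 1 by simpa using hm hz)
      simpa using this.le) (by simp) hw
  have h1 := S2aux_pick_id (h 0) (h w)
  have h2 := S2aux_den_lb (b := h 0) hhw
  have h3 : 0 < ‖1 - (starRingEnd ℂ (h 0)) * h w‖ := by linarith
  rw [norm_div, div_le_iff₀ h3] at hS
  set A := ‖1 - (starRingEnd ℂ (h 0)) * h w‖
  have h4 : ‖h w - h 0‖ ^ 2 ≤ (‖w‖ * A) ^ 2 := pow_le_pow_left₀ (norm_nonneg _) hS 2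
  have h5 : (1 - ‖h 0‖) ^ 2 ≤ A ^ 2 := pow_le_pow_left₀ (by linarith) h2 2
  have h6 : 0 ≤ 1 - ‖w‖ ^ 2 := by nlinarith [norm_nonneg w]
  have h7 : 0 ≤ 1 - ‖h w‖ ^ 2 := by nlinarith [norm_nonneg (h w)]
  nlinarith [mul_le_mul_of_nonneg_right h5 h6, mul_nonneg (sq_nonneg ‖h 0‖) h7]

/-- Schwarz–Pick (weak form). -/
lemma S2aux_pick_deriv {h : ℂ → ℂ} (hd : DifferentiableOn ℂ h (ball (0:ℂ) 1))
    (hm : Set.MapsTo h (ball (0:ℂ) 1) (ball (0:ℂ) 1)) {z : ℂ} (hz : ‖z‖ < 1) :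
    ‖deriv h z‖ * (1 - ‖z‖) ≤ 1 - ‖h z‖ ^ 2 := by
  have hzm : z ∈ ball (0:ℂ) 1 := by simpa using hz
  have hb : ‖h z‖ < 1 := by simpa using hm hzm
  have hsub : ball z (1 - ‖z‖) ⊆ ball (0:ℂ) 1 := by
    apply ball_subset_ball'
    simp
  have hS := Complex.norm_deriv_le_div_of_mapsTo_ball (R₂ := 1)
    ((S2aux_pick_diff hd hm hb).mono hsub)
    (fun w hw => by
      have := S2aux_pick_lt hb (show ‖h w‖ < 1 by simpa using hm (hsub hw))
      simpa using this.le) (by linarith)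
  have hdz : HasDerivAt h (deriv h z) z := (hd.differentiableAt (isOpen_ball.mem_nhds hzm)).hasDerivAt
  have hder := (hdz.sub_const (h z)).div ((hdz.const_mul (starRingEnd ℂ (h z))).const_sub 1)
    (S2aux_den_ne hb hb)
  have e : (1 - (starRingEnd ℂ (h z)) * h z) = ((1 - ‖h z‖ ^ 2 : ℝ) : ℂ) := by
    rw [← Complex.normSq_eq_conj_mul_self, Complex.normSq_eq_norm_sq]; push_cast; rfl
  have hpos : 0 < 1 - ‖h z‖ ^ 2 := by nlinarith [norm_nonneg (h z)]
  have e2 := hder.deriv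
  rw [sub_self, zero_mul, sub_zero, e] at e2
  have e3 : ‖deriv (fun w => (h w - h z) / (1 - (starRingEnd ℂ (h z)) * h w)) z‖ =
      ‖deriv h z‖ / (1 - ‖h z‖ ^ 2) := by
    refine (congrArg norm e2).trans ?_
    rw [norm_div, norm_mul, norm_pow, Complex.norm_real, Real.norm_of_nonneg hpos.le]
    field_simp
  rw [e3, div_le_div_iff₀ hpos (by linarith)] at hS
  linarith

/-- The inverse of a disk automorphism is holomorphic. -/
lemma S2aux_inverse {φ : ℂ → ℂ} (hφ : DifferentiableOn ℂ φ (ball (0:ℂ) 1))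
    (hb : Set.BijOn φ (ball (0:ℂ) 1) (ball (0:ℂ) 1)) :
    ∃ h : ℂ → ℂ, DifferentiableOn ℂ h (ball (0:ℂ) 1) ∧
      Set.MapsTo h (ball (0:ℂ) 1) (ball (0:ℂ) 1) ∧ ∀ z ∈ ball (0:ℂ) 1, h (φ z) = z := by
  set U := ball (0:ℂ) 1 with hU
  have hUo : IsOpen U := isOpen_ball
  have han : AnalyticOnNhd ℂ φ U := hφ.analyticOnNhd hUo
  set h := Function.invFunOn φ U with hh
  have hl : ∀ z ∈ U, h (φ z) = z := fun z hz => hb.injOn.leftInvOn_invFunOn hz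
  have hr : ∀ w ∈ U, φ (h w) = w := fun w hw => hb.surjOn.rightInvOn_invFunOn hw
  have hm : Set.MapsTo h U U := hb.surjOn.mapsTo_invFunOn
  -- not locally constant
  have hnc : ∀ z ∈ U, ¬ ∀ᶠ x in nhds z, φ x = φ z := by
    intro z hz hc
    have h1 : ∀ᶠ x in nhds z, x = z := by
      filter_upwards [hc, hUo.mem_nhds hz] with x hx hxU
      exact hb.injOn hxU hz hx
    have h2 : ∀ᶠ x in nhdsWithin z {z}ᶜ, x = z := h1.filter_mono nhdsWithin_le_nhds
    have h3 : ∀ᶠ x in nhdsWithin z {z}ᶜ, x ≠ z := eventually_mem_nhdsWithin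
    obtain ⟨x, hx1, hx2⟩ := (h2.and h3).exists
    exact hx2 hx1
  have hcont : ∀ w ∈ U, ContinuousAt h w := by
    intro w hw
    have hz := hm hw
    have hopen := (han _ hz).eventually_constant_or_nhds_le_map_nhds.resolve_left (hnc _ hz)
    rw [hr w hw] at hopen
    intro V hV
    have : Set.image φ (V ∩ U) ∈ nhds w := hopen (image_mem_map (inter_mem hV (hUo.mem_nhds hz)))
    rw [mem_map]
    filter_upwards [this]
    rintro _ ⟨x, hx, rfl⟩
    rw [Set.mem_preimage, hl x hx.2]
    exact hx.1
  have hreg : ∀ w ∈ U, deriv φ (h w) ≠ 0 → DifferentiableAt ℂ h w := by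
    intro w hw hne
    have hd : HasDerivAt φ (deriv φ (h w)) (h w) :=
      (hφ.differentiableAt (hUo.mem_nhds (hm hw))).hasDerivAt
    refine (HasDerivAt.of_local_left_inverse (hcont w hw) hd hne ?_).differentiableAt
    filter_upwards [hUo.mem_nhds hw] with x hx using hr x hx
  refine ⟨h, ?_, hm, hl⟩
  intro w hw
  apply DifferentiableAt.differentiableWithinAt
  have hz := hm hw
  have hpunct : ∀ᶠ x in nhdsWithin (h w) {h w}ᶜ, deriv φ x ≠ 0 := by
    rcases (han _ hz).deriv.eventually_eq_zero_or_eventually_ne_zero with h0 | h0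
    · exfalso
      apply hnc _ hz
      obtain ⟨ε, hε, hball⟩ := Metric.eventually_nhds_iff_ball.mp (h0.and (hUo.mem_nhds hz))
      filter_upwards [ball_mem_nhds _ hε] with x hx
      refine (convex_ball (h w) ε).is_const_of_fderivWithin_eq_zero (𝕜 := ℂ) (f := φ)
        (fun y hy => (hφ.differentiableAt (hUo.mem_nhds (hball y hy).2)).differentiableWithinAt)
        (fun y hy => ?_) hx (mem_ball_self hε)
      rw [fderivWithin_of_isOpen isOpen_ball hy]
      ext
      simpa using (hball y hy).1
    · exact h0
  have htend : Tendsto h (nhdsWithin w {w}ᶜ) (nhdsWithin (h w) {h w}ᶜ) := by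
    apply tendsto_nhdsWithin_iff.mpr
    refine ⟨(hcont w hw).tendsto.mono_left nhdsWithin_le_nhds, ?_⟩
    filter_upwards [eventually_mem_nhdsWithin, nhdsWithin_le_nhds (hUo.mem_nhds hw)] with x hx hxU
    intro hxe
    apply hx
    have : h x = h w := hxe
    rw [Set.mem_singleton_iff, ← hr x hxU, this, hr w hw]
  apply (Complex.analyticAt_of_differentiable_on_punctured_nhds_of_continuousAt _
    (hcont w hw)).differentiableAt
  filter_upwards [htend.eventually hpunct, nhdsWithin_le_nhds (hUo.mem_nhds hw)] with x hx hxU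
  exact hreg x hxU hx

lemma S2aux_deriv_bdd {φ : ℂ → ℂ} (hφ : DifferentiableOn ℂ φ (ball (0:ℂ) 1))
    (hb : Set.BijOn φ (ball (0:ℂ) 1) (ball (0:ℂ) 1)) :
    ∃ L : ℝ, ∀ z ∈ ball (0:ℂ) 1, ‖deriv φ z‖ ≤ L := by
  obtain ⟨h, hd, hm, hl⟩ := S2aux_inverse hφ hb
  have h0 : ‖h 0‖ < 1 := by simpa using hm (show (0:ℂ) ∈ ball (0:ℂ) 1 by simp)
  refine ⟨2 / (1 - ‖h 0‖) ^ 2, fun z hz => ?_⟩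
  have hz1 : ‖z‖ < 1 := by simpa using hz
  have h1 := S2aux_decay hd hm (w := φ z) (by simpa using hb.mapsTo hz)
  rw [hl z hz] at h1
  have h2 := S2aux_pick_deriv hφ hb.mapsTo hz1
  have hc : 0 < (1 - ‖h 0‖) ^ 2 := by have : 0 < 1 - ‖h 0‖ := by linarith
                                      positivity
  rw [le_div_iff₀ hc]
  have h3 := mul_le_mul_of_nonneg_left h2 hc.le
  have h4 : (‖deriv φ z‖ * (1 - ‖h 0‖) ^ 2) * (1 - ‖z‖) ≤ 2 * (1 - ‖z‖) := by
    nlinarith [norm_nonneg z]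
  exact le_of_mul_le_mul_right h4 (by linarith)

lemma S2aux_coeff_deriv (f : ℂ → ℂ) (n : ℕ) :
    taylorCoeff (deriv f) n = ((n:ℂ) + 1) * taylorCoeff f (n + 1) := by
  have h : ((n:ℂ) + 1) ≠ 0 := by exact_mod_cast n.succ_ne_zero
  have h2 : ((n.factorial : ℕ) : ℂ) ≠ 0 := by exact_mod_cast n.factorial_ne_zero
  rw [taylorCoeff, taylorCoeff, iteratedDeriv_succ', Nat.factorial_succ]
  push_cast
  field_simp

lemma S2aux_coeff_deriv_norm (f : ℂ → ℂ) (n : ℕ) :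
    ((n : ℝ) + 1) ^ 2 * ‖taylorCoeff f (n + 1)‖ ^ 2 = ‖taylorCoeff (deriv f) n‖ ^ 2 := by
  rw [S2aux_coeff_deriv, norm_mul, mul_pow]
  congr 2
  have : ((n:ℂ) + 1) = ((n + 1 : ℕ) : ℂ) := by push_cast; rfl
  rw [this, Complex.norm_natCast]
  push_cast
  rfl

lemma S2aux_coeff_zero (f : ℂ → ℂ) : taylorCoeff f 0 = f 0 := by
  simp [taylorCoeff]

lemma S2aux_normSq (f : ℂ → ℂ) :
    s2NormSq f = ‖f 0‖ ^ 2 + ∑' n : ℕ, ‖taylorCoeff (deriv f) n‖ ^ 2 := by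
  rw [s2NormSq, S2aux_coeff_zero]
  congr 2
  ext n
  exact S2aux_coeff_deriv_norm f n

lemma S2aux_normSq_nonneg (f : ℂ → ℂ) : 0 ≤ s2NormSq f := by
  rw [S2aux_normSq]
  have : 0 ≤ ∑' n : ℕ, ‖taylorCoeff (deriv f) n‖ ^ 2 := tsum_nonneg (fun n => by positivity)
  positivity

lemma S2aux_summable_iff (f : ℂ → ℂ) :
    Summable (fun n : ℕ => ((n : ℝ)) ^ 2 * ‖taylorCoeff f n‖ ^ 2) ↔
      Summable (fun n : ℕ => ‖taylorCoeff (deriv f) n‖ ^ 2) := by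
  rw [← summable_nat_add_iff 1]
  apply summable_congr
  intro n
  rw [← S2aux_coeff_deriv_norm]
  push_cast
  rfl

lemma S2aux_mem_iff (f : ℂ → ℂ) : MemS2 f ↔ DifferentiableOn ℂ f (ball (0:ℂ) 1) ∧
    Summable (fun n : ℕ => ‖taylorCoeff (deriv f) n‖ ^ 2) := by
  rw [MemS2, S2aux_summable_iff]
  constructor
  · rintro ⟨h1, _, h3⟩
    exact ⟨h1.differentiableOn, h3⟩
  · rintro ⟨h1, h3⟩
    exact ⟨h1.analyticOn isOpen_ball, fun z hz => S2aux_taylor_hasSum h1 hz, h3⟩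

/-- Point evaluations are uniformly bounded on `S²`. -/
lemma S2aux_sup : ∃ K : ℝ, 0 ≤ K ∧ ∀ f, MemS2 f → ∀ z ∈ ball (0:ℂ) 1,
    ‖f z‖ ^ 2 ≤ K * s2NormSq f := by
  have hZ : Summable (fun n : ℕ => (1 / ((n:ℝ) + 1)) ^ 2) := by
    have := (summable_nat_add_iff 1).mpr (Real.summable_one_div_nat_pow.mpr (show 1 < 2 by norm_num))
    simpa using this
  set Z := ∑' n : ℕ, (1 / ((n:ℝ) + 1)) ^ 2 with hZdef
  have hZ0 : 0 ≤ Z := tsum_nonneg (fun n => by positivity)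
  refine ⟨2 * (1 + Z), by positivity, fun f hf z hz => ?_⟩
  have hs := ((S2aux_mem_iff f).mp hf).2
  have hz1 : ‖z‖ < 1 := by simpa using hz
  have ht := (hf.2.1 z hz).tendsto_sum_nat.comp (tendsto_add_atTop_nat 1)
  refine le_of_tendsto ((ht.norm).pow 2) (Eventually.of_forall fun m => ?_)
  rw [S2aux_normSq]
  set S := ∑' n : ℕ, ‖taylorCoeff (deriv f) n‖ ^ 2 with hS
  have hS0 : 0 ≤ S := tsum_nonneg (fun n => by positivity)
  have h1 : ‖∑ i ∈ Finset.range (m + 1), taylorCoeff f i * z ^ i‖ ≤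
      ‖f 0‖ + ∑ n ∈ Finset.range m, (1 / ((n:ℝ) + 1)) * ‖taylorCoeff (deriv f) n‖ := by
    rw [Finset.sum_range_succ', pow_zero, mul_one, S2aux_coeff_zero, add_comm]
    refine (norm_add_le _ _).trans ?_
    gcongr
    refine (norm_sum_le _ _).trans ?_
    gcongr with n hn
    have e : ‖taylorCoeff (deriv f) n‖ = ((n:ℝ) + 1) * ‖taylorCoeff f (n + 1)‖ := by
      rw [← sq_eq_sq₀ (norm_nonneg _) (by positivity), ← S2aux_coeff_deriv_norm, mul_pow]
    rw [e, norm_mul, norm_pow]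
    have : (1 / ((n:ℝ) + 1)) * (((n:ℝ) + 1) * ‖taylorCoeff f (n + 1)‖) =
      ‖taylorCoeff f (n + 1)‖ := by field_simp
    rw [this]
    apply mul_le_of_le_one_right (norm_nonneg _)
    exact pow_le_one₀ (norm_nonneg _) hz1.le
  have h2 := Finset.sum_mul_sq_le_sq_mul_sq (Finset.range m) (fun n : ℕ => 1 / ((n:ℝ) + 1))
    (fun n => ‖taylorCoeff (deriv f) n‖)
  have h3 : ∑ n ∈ Finset.range m, (1 / ((n:ℝ) + 1)) ^ 2 ≤ Z :=
    hZ.sum_le_tsum _ (fun n _ => by positivity)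
  have h4 : ∑ n ∈ Finset.range m, ‖taylorCoeff (deriv f) n‖ ^ 2 ≤ S :=
    hs.sum_le_tsum _ (fun n _ => by positivity)
  have h5 := h2.trans (mul_le_mul h3 h4 (Finset.sum_nonneg fun n _ => by positivity) hZ0)
  have h6 := pow_le_pow_left₀ (norm_nonneg _) h1 2
  simp only [Function.comp_apply]
  set Y := ∑ n ∈ Finset.range m, (1 / ((n:ℝ) + 1)) * ‖taylorCoeff (deriv f) n‖
  nlinarith [sq_nonneg (‖f 0‖ - Y), mul_nonneg hZ0 (sq_nonneg ‖f 0‖)]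

lemma S2aux_main {ψ φ : ℂ → ℂ} (hψ : MemS2 ψ) (hφ : IsDiskAut φ) :
    ∃ C : ℝ, 0 ≤ C ∧ ∀ f, MemS2 f → MemS2 (fun z => ψ z * f (φ z)) ∧
      s2NormSq (fun z => ψ z * f (φ z)) ≤ C * s2NormSq f := by
  obtain ⟨K, hK0, hK⟩ := S2aux_sup
  have hφd := hφ.1.differentiableOn
  have hφm := hφ.2.mapsTo
  obtain ⟨L, hL⟩ := S2aux_deriv_bdd hφd hφ.2
  obtain ⟨hψd, hψs⟩ := (S2aux_mem_iff ψ).mp hψ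
  have ha : ‖φ 0‖ < 1 := by simpa using hφm (show (0:ℂ) ∈ ball (0:ℂ) 1 by simp)
  set c := 4 / (1 - ‖φ 0‖) with hc
  have hc0 : 0 ≤ c := div_nonneg (by norm_num) (by linarith)
  set P := s2NormSq ψ with hP
  have hP0 : 0 ≤ P := S2aux_normSq_nonneg ψ
  refine ⟨K * P * K + (2 * K * P + 2 * (K * P) * L ^ 2 * c), by positivity, fun f hf => ?_⟩
  obtain ⟨hfd, hfs⟩ := (S2aux_mem_iff f).mp hf
  set N := s2NormSq f with hN
  have hN0 : 0 ≤ N := S2aux_normSq_nonneg f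
  have hTd : DifferentiableOn ℂ (fun z => ψ z * f (φ z)) (ball (0:ℂ) 1) :=
    hψd.mul (hfd.comp hφd hφm)
  have hψ'd : DifferentiableOn ℂ (deriv ψ) (ball (0:ℂ) 1) := hψd.deriv isOpen_ball
  have hf'd : DifferentiableOn ℂ (deriv f) (ball (0:ℂ) 1) := hfd.deriv isOpen_ball
  have hT'd := hTd.deriv isOpen_ball
  have hpt : ∀ z ∈ ball (0:ℂ) 1, ‖deriv (fun z => ψ z * f (φ z)) z‖ ^ 2 ≤
      2 * (K * N) * ‖deriv ψ z‖ ^ 2 + 2 * (K * P) * L ^ 2 * ‖deriv f (φ z)‖ ^ 2 := by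
    intro z hz
    have d1 := (hψd.differentiableAt (isOpen_ball.mem_nhds hz)).hasDerivAt
    have d2 := (hφd.differentiableAt (isOpen_ball.mem_nhds hz)).hasDerivAt
    have d3 := (hfd.differentiableAt (isOpen_ball.mem_nhds (hφm hz))).hasDerivAt
    have d4 := (d1.mul (d3.comp z d2)).deriv
    have e : deriv (fun z => ψ z * f (φ z)) z =
        deriv ψ z * f (φ z) + ψ z * (deriv f (φ z) * deriv φ z) := d4
    rw [e]
    have n1 := norm_add_le (deriv ψ z * f (φ z)) (ψ z * (deriv f (φ z) * deriv φ z))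
    have n2 := pow_le_pow_left₀ (norm_nonneg _) n1 2
    have n3 : ‖deriv ψ z * f (φ z)‖ ^ 2 ≤ K * N * ‖deriv ψ z‖ ^ 2 := by
      rw [norm_mul, mul_pow, mul_comm]
      gcongr
      exact hK f hf _ (hφm hz)
    have n4 : ‖ψ z * (deriv f (φ z) * deriv φ z)‖ ^ 2 ≤
        K * P * L ^ 2 * ‖deriv f (φ z)‖ ^ 2 := by
      rw [norm_mul, norm_mul, mul_pow, mul_pow, mul_assoc (K * P), mul_comm (L ^ 2)]
      gcongr
      · exact hK ψ hψ _ hz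
      · exact hL z hz
    nlinarith [sq_nonneg (‖deriv ψ z * f (φ z)‖ - ‖ψ z * (deriv f (φ z) * deriv φ z)‖)]
  have hSψ : ∑' n : ℕ, ‖taylorCoeff (deriv ψ) n‖ ^ 2 ≤ P := by
    rw [hP, S2aux_normSq]; linarith [sq_nonneg ‖ψ 0‖]
  have hSf : ∑' n : ℕ, ‖taylorCoeff (deriv f) n‖ ^ 2 ≤ N := by
    rw [hN, S2aux_normSq]; linarith [sq_nonneg ‖f 0‖]
  have hmeans : ∀ r : ℝ, 0 < r → r < 1 →
      Real.circleAverage (fun z => ‖deriv (fun z => ψ z * f (φ z)) z‖ ^ 2) 0 r ≤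
        (2 * K * P + 2 * (K * P) * L ^ 2 * c) * N := by
    intro r h0 h1
    have i1 : CircleIntegrable (fun z => ‖deriv ψ z‖ ^ 2) 0 r :=
      S2aux_circleInt (hψ'd.continuousOn.norm.pow 2) h0 h1
    have i2 : CircleIntegrable (fun z => ‖deriv f (φ z)‖ ^ 2) 0 r :=
      S2aux_circleInt ((hf'd.comp hφd hφm).continuousOn.norm.pow 2) h0 h1
    have j1 : CircleIntegrable ((2 * (K * N)) • fun z => ‖deriv ψ z‖ ^ 2) 0 r := i1.const_smul
    have j2 : CircleIntegrable ((2 * (K * P) * L ^ 2) • fun z => ‖deriv f (φ z)‖ ^ 2) 0 r :=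
      i2.const_smul
    have m1 : Real.circleAverage (fun z => ‖deriv (fun z => ψ z * f (φ z)) z‖ ^ 2) 0 r ≤
        Real.circleAverage (((2 * (K * N)) • fun z => ‖deriv ψ z‖ ^ 2) +
          ((2 * (K * P) * L ^ 2) • fun z => ‖deriv f (φ z)‖ ^ 2)) 0 r := by
      apply Real.circleAverage_mono (S2aux_circleInt (hT'd.continuousOn.norm.pow 2) h0 h1)
        (j1.add j2)
      intro z hz
      apply hpt
      rw [abs_of_pos h0] at hz
      exact closedBall_subset_ball h1 (sphere_subset_closedBall hz)
    rw [Real.circleAverage_add j1 j2, Real.circleAverage_smul, Real.circleAverage_smul,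
      smul_eq_mul, smul_eq_mul] at m1
    have b1 := (S2aux_means_le hψ'd hψs h0 h1).trans hSψ
    have b2 := (S2aux_littlewood hf'd hφd hφm hfs h0 h1).trans
      (mul_le_mul_of_nonneg_left hSf hc0)
    calc _ ≤ _ := m1
      _ ≤ 2 * (K * N) * P + 2 * (K * P) * L ^ 2 * (c * N) := by gcongr
      _ = _ := by ring
  obtain ⟨q1, q2⟩ := S2aux_summable_of_means hT'd hmeans
  refine ⟨(S2aux_mem_iff _).mpr ⟨hTd, q1⟩, ?_⟩
  rw [S2aux_normSq, add_mul]
  refine add_le_add ?_ q2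
  rw [norm_mul, mul_pow]
  have h0m : (0:ℂ) ∈ ball (0:ℂ) 1 := by simp
  calc ‖ψ 0‖ ^ 2 * ‖f (φ 0)‖ ^ 2 ≤ (K * P) * (K * N) := by
        gcongr
        · exact hK ψ hψ 0 h0m
        · exact hK f hf _ (hφm h0m)
    _ = _ := by ring

theorem weighted_composition_bounded_iff (ψ φ : ℂ → ℂ)
    (hψ : AnalyticOn ℂ ψ (ball (0:ℂ) 1)) (hφ : IsDiskAut φ) :
    BoundedOpS2 (fun f => fun z => ψ z * f (φ z)) ↔ MemS2 ψ := by
  constructor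
  · rintro ⟨h, _⟩
    have h1 : MemS2 (fun _ => (1:ℂ)) := by
      rw [S2aux_mem_iff]
      refine ⟨differentiableOn_const 1, ?_⟩
      have : ∀ n, taylorCoeff (deriv fun _ : ℂ => (1:ℂ)) n = 0 := by
        intro n
        simp [taylorCoeff]
      simp only [this]
      simp [summable_zero]
    simpa using h _ h1
  · intro h
    obtain ⟨C, hC0, hC⟩ := S2aux_main h hφ
    refine ⟨fun f hf => (hC f hf).1, Real.sqrt C, fun f hf => ?_⟩
    rw [s2Norm, s2Norm, ← Real.sqrt_mul hC0]
    exact Real.sqrt_le_sqrt (hC f hf).2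
end

section
/- For φ an automorphism of the unit disk and f ∈ S^2, one has ‖(f∘φ)'‖_{H^2}^2 ≤ ((1+|φ(0)|)/(1−|φ(0)|)) ‖f‖_{S^2}^2. -/
open Metric Filter

open Real in
lemma aux_poisson_cont {w : ℂ} (hw : w ∈ ball (0:ℂ) 1) :
    ContinuousOn (poissonKernel 0 w) (sphere (0:ℂ) 1) := by
  unfold poissonKernel
  refine ContinuousOn.div (by fun_prop) (by fun_prop) ?_
  intro z hz h
  simp at h hz hw
  have : z = w := sub_eq_zero.mp h
  rw [this] at hz; linarith

/-- The basic isometry step: on the circle `|b + uR|² = |b|² + |R|² + 2 Re (conj b · uR)`. -/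
lemma aux_step {w b : ℂ} {u R : ℂ → ℂ} (hw : w ∈ ball (0:ℂ) 1)
    (hu : DiffContOnCl ℂ u (ball (0:ℂ) 1)) (hR : DiffContOnCl ℂ R (ball (0:ℂ) 1))
    (hu1 : ∀ z ∈ sphere (0:ℂ) 1, ‖u z‖ = 1) (huw : u w = 0) :
    Real.circleAverage (fun z => poissonKernel 0 w z * ‖b + u z * R z‖^2) 0 1 =
      ‖b‖^2 + Real.circleAverage (fun z => poissonKernel 0 w z * ‖R z‖^2) 0 1 := by
  have hcl : closure (ball (0:ℂ) 1) = closedBall 0 1 := closure_ball _ one_ne_zero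
  have hP := aux_poisson_cont hw
  have cR : ContinuousOn R (sphere (0:ℂ) 1) :=
    hR.continuousOn.mono (by rw [hcl]; exact sphere_subset_closedBall)
  have cu : ContinuousOn u (sphere (0:ℂ) 1) :=
    hu.continuousOn.mono (by rw [hcl]; exact sphere_subset_closedBall)
  let V : ℂ → ℂ := fun z => (‖b‖^2 : ℝ) + 2 * (starRingEnd ℂ b) * (u z * R z)
  have hV : DiffContOnCl ℂ V (ball (0:ℂ) 1) := by
    have h1 := ((hu.smul hR).const_smul (2 * (starRingEnd ℂ b))).const_add (((‖b‖^2 : ℝ) : ℂ))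
    exact h1
  have key := hV.circleAverage_poissonKernel_smul hw
  have cV : ContinuousOn V (sphere (0:ℂ) 1) :=
    hV.continuousOn.mono (by rw [hcl]; exact sphere_subset_closedBall)
  have iV : CircleIntegrable (poissonKernel 0 w • V) 0 1 :=
    ContinuousOn.circleIntegrable zero_le_one (hP.smul cV)
  have h2 := Complex.reCLM.circleAverage_comp_comm iV
  rw [key] at h2
  have hVw : Complex.reCLM (V w) = ‖b‖^2 := by
    simp [V, huw, -Complex.ofReal_pow]
  rw [hVw] at h2
  rw [← h2, ← Real.circleAverage_add]
  · apply Real.circleAverage_congr_sphere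
    intro z hz
    have hz' : z ∈ sphere (0:ℂ) 1 := by simpa using hz
    have hn := hu1 z hz'
    have e1 : ‖b + u z * R z‖^2 = ‖b‖^2 + 2 * (starRingEnd ℂ b * (u z * R z)).re
        + ‖R z‖^2 := by
      have h5 := Complex.normSq_add (u z * R z) b
      rw [Complex.normSq_eq_norm_sq, Complex.normSq_eq_norm_sq, Complex.normSq_eq_norm_sq,
        norm_mul, hn, one_mul] at h5
      rw [add_comm b, h5, mul_comm (starRingEnd ℂ b)]
      ring
    simp only [Pi.add_apply, Function.comp_apply, Pi.smul_apply', Complex.reCLM_apply, e1, V]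
    simp [-Complex.ofReal_pow, mul_assoc]
    ring
  · exact ContinuousOn.circleIntegrable zero_le_one
      (Complex.reCLM.continuous.comp_continuousOn (hP.smul cV))
  · exact ContinuousOn.circleIntegrable zero_le_one (hP.mul (cR.norm.pow 2))

lemma aux_isometry {w : ℂ} {u : ℂ → ℂ} (hw : w ∈ ball (0:ℂ) 1)
    (hu : DiffContOnCl ℂ u (ball (0:ℂ) 1))
    (hu1 : ∀ z ∈ sphere (0:ℂ) 1, ‖u z‖ = 1) (huw : u w = 0) (N : ℕ) : ∀ (b : ℕ → ℂ),
    Real.circleAverage (fun z => poissonKernel 0 w z * ‖∑ n ∈ Finset.range N, b n * u z ^ n‖^2) 0 1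
     = ∑ n ∈ Finset.range N, ‖b n‖^2 := by
  induction N with
  | zero => intro b; simp [Real.circleAverage]
  | succ N ih =>
    intro b
    have hR : DiffContOnCl ℂ (fun z => ∑ n ∈ Finset.range N, b (n+1) * u z ^ n)
        (ball (0:ℂ) 1) := by
      refine ⟨?_, ?_⟩
      · have := hu.differentiableOn
        fun_prop
      · have := hu.continuousOn
        fun_prop
    have := aux_step (b := b 0) hw hu hR hu1 huw
    rw [ih (fun n => b (n+1))] at this
    rw [Finset.sum_range_succ' (fun n => ‖b n‖^2), add_comm (∑ k ∈ Finset.range N, _), ← this]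
    congr 1
    ext z
    rw [Finset.sum_range_succ', add_comm (∑ k ∈ Finset.range N, _), Finset.mul_sum]
    congr 4
    · simp
    · apply Finset.sum_congr rfl
      intros; ring

lemma aux_taylor_dslope {G : ℂ → ℂ} (hG : AnalyticAt ℂ G 0) (j : ℕ) :
    taylorCoeff (dslope G 0) j = taylorCoeff G (j+1) := by
  have h1 := hG.hasFPowerSeriesAt
  have h2 := h1.has_fpower_series_dslope_fslope
  have h3 := h2.analyticAt.hasFPowerSeriesAt
  have h4 := congrArg (fun p => p.coeff j) (h3.eq_formalMultilinearSeries h2)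
  simp only [FormalMultilinearSeries.coeff_fslope, FormalMultilinearSeries.coeff_ofScalars] at h4
  exact h4

lemma aux_bessel {r : ℝ} (hr : 1 < r) (M : ℕ) : ∀ G : ℂ → ℂ, DifferentiableOn ℂ G (ball 0 r) →
    ∑ j ∈ Finset.range M, ‖taylorCoeff G j‖^2 ≤ Real.circleAverage (fun z => ‖G z‖^2) 0 1 := by
  induction M with
  | zero =>
    intro G hG
    simp only [Finset.range_zero, Finset.sum_empty]
    exact Real.circleAverage_nonneg_of_nonneg (fun z _ => by positivity)
  | succ M ih =>
    intro G hG
    have hmem : ball (0:ℂ) r ∈ nhds (0:ℂ) := ball_mem_nhds _ (by linarith)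
    have hd := (Complex.differentiableOn_dslope hmem).2 hG
    have hsub : closedBall (0:ℂ) 1 ⊆ ball 0 r := closedBall_subset_ball hr
    have := aux_step (b := G 0) (w := 0) (u := fun z => z) (R := dslope G 0) (by simp)
      (differentiable_id.diffContOnCl) ((hd.mono hsub).diffContOnCl_ball le_rfl)
      (by intro z hz; simpa using hz) rfl
    have e1 : Real.circleAverage (fun z => ‖G z‖^2) 0 1 = Real.circleAverage
        (fun z => poissonKernel 0 0 z * ‖G 0 + z * dslope G 0 z‖^2) 0 1 := by
      apply Real.circleAverage_congr_sphere
      intro z hz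
      have hz' : ‖z‖ = 1 := by simpa using hz
      have : G z = G 0 + z * dslope G 0 z := by
        have := sub_smul_dslope G 0 z
        simp at this
        rw [this]; ring
      simp only [poissonKernel]
      rw [← this]; simp [hz']
    have e2 : Real.circleAverage (fun z => ‖dslope G 0 z‖^2) 0 1 = Real.circleAverage
        (fun z => poissonKernel 0 0 z * ‖dslope G 0 z‖^2) 0 1 := by
      apply Real.circleAverage_congr_sphere
      intro z hz
      have hz' : ‖z‖ = 1 := by simpa using hz
      simp [poissonKernel, hz']
    rw [e1, this, ← e2, Finset.sum_range_succ', add_comm]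
    have e3 : taylorCoeff G 0 = G 0 := by simp [taylorCoeff]
    rw [e3]
    have h4 := ih _ hd
    simp_rw [aux_taylor_dslope (hG.analyticAt hmem)] at h4
    gcongr

/-- The Möbius map `z ↦ μ (z + c) / (1 + c̄ z)`. -/
noncomputable def auxMob (μ c z : ℂ) : ℂ := μ * (z + c) / (1 + starRingEnd ℂ c * z)

lemma aux_den_ne {c z : ℂ} (h : ‖c‖ * ‖z‖ < 1) : 1 + starRingEnd ℂ c * z ≠ 0 := by
  intro h0
  have h1 : starRingEnd ℂ c * z = -1 := by linear_combination h0
  have h2 := congrArg norm h1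
  simp at h2
  linarith

lemma aux_norm_sq (c z : ℂ) : ‖1 + starRingEnd ℂ c * z‖^2 - ‖z + c‖^2 =
    (1 - ‖c‖^2) * (1 - ‖z‖^2) := by
  simp only [← Complex.normSq_eq_norm_sq, Complex.normSq_apply]
  simp
  ring

lemma aux_mob_deriv {μ c z : ℂ} (h : ‖c‖ * ‖z‖ < 1) :
    HasDerivAt (auxMob μ c) (μ * (1 - ‖c‖^2) / (1 + starRingEnd ℂ c * z)^2) z := by
  have hne := aux_den_ne h
  have h1 : HasDerivAt (fun z => μ * (z + c)) μ z := by
    simpa using ((hasDerivAt_id z).add_const c).const_mul μ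
  have h2 : HasDerivAt (fun z => 1 + starRingEnd ℂ c * z) (starRingEnd ℂ c) z := by
    simpa using ((hasDerivAt_id z).const_mul (starRingEnd ℂ c)).const_add 1
  have h3 := h1.div h2 hne
  refine h3.congr_deriv ?_
  congr 1
  have := Complex.mul_conj' c
  linear_combination (-μ) * this

lemma aux_poly {μ c : ℂ} (hμ : ‖μ‖ = 1) (hc : ‖c‖ < 1) (a : ℕ → ℂ) (N M : ℕ) :
    ∑ j ∈ Finset.range M, ‖taylorCoeff
      (deriv (fun z => ∑ n ∈ Finset.range (N+1), a n * auxMob μ c z ^ n)) j‖^2 ≤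
      ((1 + ‖c‖) / (1 - ‖c‖)) * ∑ n ∈ Finset.range N, ((n:ℝ)+1)^2 * ‖a (n+1)‖^2 := by
  have hc0 := norm_nonneg c
  set r : ℝ := 2 / (1 + ‖c‖) with hrdef
  have hr : 1 < r := by rw [hrdef, lt_div_iff₀ (by linarith)]; linarith
  have hrc : ‖c‖ * r < 1 := by
    rw [hrdef, ← mul_div_assoc, div_lt_one (by linarith)]; linarith
  have hz1 : ∀ z ∈ ball (0:ℂ) r, ‖c‖ * ‖z‖ < 1 := by
    intro z hz
    have : ‖z‖ < r := by simpa using hz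
    nlinarith
  have hm : DifferentiableOn ℂ (auxMob μ c) (ball 0 r) := fun z hz =>
    (aux_mob_deriv (hz1 z hz)).differentiableAt.differentiableWithinAt
  have hG : DifferentiableOn ℂ (deriv (fun z => ∑ n ∈ Finset.range (N+1), a n * auxMob μ c z ^ n))
      (ball 0 r) := by
    apply DifferentiableOn.deriv _ isOpen_ball
    fun_prop
  refine (aux_bessel hr M _ hG).trans ?_
  have hsub : closedBall (0:ℂ) 1 ⊆ ball 0 r := closedBall_subset_ball hr
  have hsub' : sphere (0:ℂ) 1 ⊆ ball 0 r := sphere_subset_closedBall.trans hsub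
  have hw : -c ∈ ball (0:ℂ) 1 := by simpa using hc
  have hden : ∀ z ∈ sphere (0:ℂ) 1, ‖1 + starRingEnd ℂ c * z‖ = ‖z + c‖ := by
    intro z hz
    have h1 := aux_norm_sq c z
    have h2 : ‖z‖ = 1 := by simpa using hz
    rw [h2] at h1
    have h3 : ‖1 + starRingEnd ℂ c * z‖^2 = ‖z + c‖^2 := by linarith
    exact (pow_left_inj₀ (norm_nonneg _) (norm_nonneg _) two_ne_zero).1 h3
  have hpos : ∀ z ∈ sphere (0:ℂ) 1, 0 < ‖z + c‖ := by
    intro z hz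
    rw [← hden z hz]
    exact norm_pos_iff.2 (aux_den_ne (hz1 z (hsub' hz)))
  have hiso := aux_isometry (u := auxMob μ c) hw ((hm.mono hsub).diffContOnCl_ball le_rfl)
    (by
      intro z hz
      rw [auxMob, norm_div, norm_mul, hμ, hden z hz, one_mul, div_self (hpos z hz).ne'])
    (by simp [auxMob]) N (fun n => ((n:ℂ)+1) * a (n+1))
  have hsum : ∑ n ∈ Finset.range N, ((n:ℝ)+1)^2 * ‖a (n+1)‖^2 =
      ∑ n ∈ Finset.range N, ‖((n:ℂ)+1) * a (n+1)‖^2 := by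
    apply Finset.sum_congr rfl
    intro n _
    rw [norm_mul, mul_pow]
    congr 2
    have : ((n:ℂ)+1) = ((n+1 : ℕ) : ℂ) := by push_cast; ring
    rw [this, Complex.norm_natCast]; push_cast; ring
  rw [hsum, ← hiso, ← smul_eq_mul, ← Real.circleAverage_fun_smul]
  have cm : ContinuousOn (auxMob μ c) (sphere (0:ℂ) 1) := (hm.mono hsub').continuousOn
  apply Real.circleAverage_mono
  · exact ContinuousOn.circleIntegrable zero_le_one ((hG.mono hsub').continuousOn.norm.pow 2)
  · refine ContinuousOn.circleIntegrable zero_le_one ?_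
    have := aux_poisson_cont hw
    fun_prop
  · intro z hz
    have hz' : z ∈ sphere (0:ℂ) 1 := by simpa using hz
    have hzn : ‖z‖ = 1 := by simpa using hz'
    have hd : HasDerivAt (fun z => ∑ n ∈ Finset.range (N+1), a n * auxMob μ c z ^ n)
      (∑ n ∈ Finset.range (N+1), a n * ((n:ℂ) * auxMob μ c z ^ (n-1) *
        (μ * (1 - ‖c‖^2) / (1 + starRingEnd ℂ c * z)^2))) z := by
      apply HasDerivAt.fun_sum
      intro n _
      exact ((aux_mob_deriv (hz1 z (hsub' hz'))).fun_pow n).const_mul _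
    have hd' : deriv (fun z => ∑ n ∈ Finset.range (N+1), a n * auxMob μ c z ^ n) z =
        (μ * (1 - ‖c‖^2) / (1 + starRingEnd ℂ c * z)^2) *
          ∑ n ∈ Finset.range N, ((n:ℂ)+1) * a (n+1) * auxMob μ c z ^ n := by
      rw [hd.deriv, Finset.sum_range_succ', Finset.mul_sum]
      simp only [Nat.cast_zero, zero_mul, mul_zero, add_zero]
      apply Finset.sum_congr rfl
      intro n _
      simp only [Nat.add_sub_cancel]
      push_cast
      ring
    have hPk : poissonKernel 0 (-c) z = (1 - ‖c‖^2) / ‖z + c‖^2 := by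
      simp [poissonKernel, hzn]
    have hnm : ‖μ * (1 - ‖c‖^2) / (1 + starRingEnd ℂ c * z)^2‖ = poissonKernel 0 (-c) z := by
      have h1 : ((1:ℂ) - ‖c‖^2) = ((1 - ‖c‖^2 : ℝ) : ℂ) := by push_cast; ring
      rw [hPk, norm_div, norm_mul, hμ, norm_pow, hden z hz', one_mul, h1, Complex.norm_real,
        Real.norm_of_nonneg (by nlinarith)]
    have hP0 : 0 ≤ poissonKernel 0 (-c) z := by rw [← hnm]; positivity
    have hPC : poissonKernel 0 (-c) z ≤ (1 + ‖c‖) / (1 - ‖c‖) := by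
      have h1 : 1 - ‖c‖ ≤ ‖z + c‖ := by
        have := norm_sub_le_norm_add z c
        rwa [hzn] at this
      have h2 := hpos z hz'
      rw [hPk, div_le_div_iff₀ (by positivity) (by linarith)]
      have h3 : (1 - ‖c‖)^2 ≤ ‖z + c‖^2 := by
        apply pow_le_pow_left₀ _ h1; linarith
      nlinarith
    rw [hd', norm_mul, hnm, mul_pow, smul_eq_mul, sq (poissonKernel 0 (-c) z), mul_assoc]
    gcongr

open Topology in
lemma aux_inverse {φ : ℂ → ℂ} (hφ : IsDiskAut φ) :
    ∃ ψ : ℂ → ℂ, DifferentiableOn ℂ ψ (ball 0 1) ∧ Set.MapsTo ψ (ball 0 1) (ball 0 1) ∧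
      ∀ z ∈ ball (0:ℂ) 1, ψ (φ z) = z := by
  obtain ⟨hA, hmaps, hinj, hsurj⟩ := hφ
  have hA' : ∀ z ∈ ball (0:ℂ) 1, AnalyticAt ℂ φ z := by
    intro z hz
    exact (isOpen_ball.analyticOn_iff_analyticOnNhd.1 hA) z hz
  have hnonc : ∀ z ∈ ball (0:ℂ) 1, ¬ ∀ᶠ y in 𝓝 z, φ y = φ z := by
    intro z hz hev
    have h1 : ∀ᶠ y in 𝓝 z, y = z := by
      filter_upwards [hev, isOpen_ball.mem_nhds hz] with y hy hy'
      exact hinj hy' hz hy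
    have h2 : ∀ᶠ y in 𝓝[≠] z, False := by
      filter_upwards [h1.filter_mono nhdsWithin_le_nhds, self_mem_nhdsWithin] with y hy hy'
      exact hy' hy
    exact (h2.exists).elim fun _ h => h
  let ψ := Function.invFunOn φ (ball (0:ℂ) 1)
  have hl : ∀ z ∈ ball (0:ℂ) 1, ψ (φ z) = z := fun z hz => hinj.leftInvOn_invFunOn hz
  have hmψ : Set.MapsTo ψ (ball 0 1) (ball 0 1) := hsurj.mapsTo_invFunOn
  have hr : ∀ w ∈ ball (0:ℂ) 1, φ (ψ w) = w := fun w hw => hsurj.rightInvOn_invFunOn hw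
  have hcont : ∀ w ∈ ball (0:ℂ) 1, ContinuousAt ψ w := by
    intro w hw
    have hz := hmψ hw
    have h1 := ((hA' _ hz).eventually_constant_or_nhds_le_map_nhds).resolve_left (hnonc _ hz)
    rw [hr w hw] at h1
    have h2 : Tendsto (ψ ∘ φ) (𝓝 (ψ w)) (𝓝 (ψ w)) := by
      refine tendsto_id.congr' ?_
      filter_upwards [isOpen_ball.mem_nhds hz] with y hy
      exact (hl y hy).symm
    exact (tendsto_map'_iff.2 h2).mono_left h1
  have hdiff : ∀ w ∈ ball (0:ℂ) 1, deriv φ (ψ w) ≠ 0 → DifferentiableAt ℂ ψ w := by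
    intro w hw h0
    refine (HasDerivAt.of_local_left_inverse (hcont w hw)
      (hA' _ (hmψ hw)).differentiableAt.hasDerivAt h0 ?_).differentiableAt
    filter_upwards [isOpen_ball.mem_nhds hw] with y hy
    exact hr y hy
  refine ⟨ψ, ?_, hmψ, hl⟩
  intro w hw
  have hz := hmψ hw
  refine (Complex.analyticAt_of_differentiable_on_punctured_nhds_of_continuousAt ?_
    (hcont w hw)).differentiableAt.differentiableWithinAt
  have hd0 : ∀ᶠ y in 𝓝[≠] (ψ w), deriv φ y ≠ 0 := by
    refine ((hA' _ hz).deriv.eventually_eq_zero_or_eventually_ne_zero).resolve_left ?_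
    intro hev
    apply hnonc _ hz
    obtain ⟨ε, hε, hb⟩ := Metric.eventually_nhds_iff_ball.1
      (hev.and (isOpen_ball.mem_nhds hz))
    filter_upwards [ball_mem_nhds _ hε] with y hy
    refine isOpen_ball.is_const_of_deriv_eq_zero (convex_ball (ψ w) ε).isPreconnected
      (fun x hx => (hA' x (hb x hx).2).differentiableAt.differentiableWithinAt) ?_ hy
      (mem_ball_self hε)
    intro x hx
    exact (hb x hx).1
  have ht : Tendsto ψ (𝓝[≠] w) (𝓝[≠] (ψ w)) := by
    refine tendsto_nhdsWithin_iff.2 ⟨(hcont w hw).mono_left nhdsWithin_le_nhds, ?_⟩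
    filter_upwards [self_mem_nhdsWithin, mem_nhdsWithin_of_mem_nhds (isOpen_ball.mem_nhds hw)]
      with y hy hy' he
    apply hy
    have : ψ y = ψ w := he
    have h3 := congrArg φ this
    rwa [hr y hy', hr w hw] at h3
  filter_upwards [ht.eventually hd0, mem_nhdsWithin_of_mem_nhds (isOpen_ball.mem_nhds hw)]
    with y hy hy'
  exact hdiff y hy' hy

lemma aux_mob_maps {c : ℂ} (hc : ‖c‖ < 1) {z : ℂ} (hz : ‖z‖ < 1) : ‖auxMob 1 c z‖ < 1 := by
  have hne : 1 + starRingEnd ℂ c * z ≠ 0 := aux_den_ne (by nlinarith [norm_nonneg c, norm_nonneg z])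
  rw [auxMob, norm_div, one_mul, div_lt_one (norm_pos_iff.2 hne)]
  have h1 := aux_norm_sq c z
  have h2 : 0 < (1 - ‖c‖^2) * (1 - ‖z‖^2) := by
    apply mul_pos <;> nlinarith [norm_nonneg c, norm_nonneg z]
  apply lt_of_pow_lt_pow_left₀ 2 (norm_nonneg _)
  linarith

lemma aux_mob_diff {μ c : ℂ} (hc : ‖c‖ < 1) : DifferentiableOn ℂ (auxMob μ c) (ball 0 1) := by
  intro z hz
  have hz : ‖z‖ < 1 := by simpa using hz
  exact (aux_mob_deriv (by nlinarith [norm_nonneg c, norm_nonneg z])).differentiableAt.differentiableWithinAt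

lemma aux_mob_inv {c : ℂ} (hc : ‖c‖ < 1) {z : ℂ} (hz : ‖z‖ < 1) :
    auxMob 1 c (auxMob 1 (-c) z) = z := by
  have h1 : 1 + starRingEnd ℂ (-c) * z ≠ 0 :=
    aux_den_ne (by rw [norm_neg]; nlinarith [norm_nonneg c, norm_nonneg z])
  have hw : ‖auxMob 1 (-c) z‖ < 1 := aux_mob_maps (by simpa using hc) hz
  have h2 : 1 + starRingEnd ℂ c * auxMob 1 (-c) z ≠ 0 :=
    aux_den_ne (by nlinarith [norm_nonneg c, norm_nonneg (auxMob 1 (-c) z)])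
  rw [auxMob, div_eq_iff h2]
  have h3 : auxMob 1 (-c) z * (1 + starRingEnd ℂ (-c) * z) = z - c := by
    rw [auxMob, div_mul_cancel₀ _ h1]; ring
  simp only [map_neg] at h3
  linear_combination h3

lemma aux_form {φ : ℂ → ℂ} (hφ : IsDiskAut φ) : ∃ μ c : ℂ, ‖μ‖ = 1 ∧ ‖c‖ = ‖φ 0‖ ∧ ‖c‖ < 1 ∧
    ∀ z ∈ ball (0:ℂ) 1, φ z = auxMob μ c z := by
  obtain ⟨ψ, hψd, hψm, hψl⟩ := aux_inverse hφ
  obtain ⟨hA, hmaps, hinj, hsurj⟩ := hφ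
  have h0 : (0:ℂ) ∈ ball (0:ℂ) 1 := by simp
  set b := φ 0 with hb
  have hb1 : ‖b‖ < 1 := by simpa using hmaps h0
  have hb1' : ‖-b‖ < 1 := by simpa using hb1
  let F : ℂ → ℂ := fun z => auxMob 1 (-b) (φ z)
  let K : ℂ → ℂ := fun z => ψ (auxMob 1 b z)
  have mb : ∀ c : ℂ, ‖c‖ < 1 → Set.MapsTo (auxMob 1 c) (ball 0 1) (ball 0 1) := by
    intro c hc z hz
    have : ‖z‖ < 1 := by simpa using hz
    simpa using aux_mob_maps hc this
  have hFm : Set.MapsTo F (ball 0 1) (ball 0 1) := (mb _ hb1').comp hmaps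
  have hFd : DifferentiableOn ℂ F (ball 0 1) :=
    (aux_mob_diff hb1').comp hA.differentiableOn hmaps
  have hKm : Set.MapsTo K (ball 0 1) (ball 0 1) := hψm.comp (mb _ hb1)
  have hKd : DifferentiableOn ℂ K (ball 0 1) := hψd.comp (aux_mob_diff hb1) (mb _ hb1)
  have hF0 : F 0 = 0 := by simp [F, auxMob, ← hb]
  have hK0 : K 0 = 0 := by
    have : auxMob 1 b 0 = b := by simp [auxMob]
    simp only [K, this]
    exact hψl 0 h0
  have hFn : ∀ z ∈ ball (0:ℂ) 1, ‖F z‖ = ‖z‖ := by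
    intro z hz
    apply le_antisymm
    · exact Complex.norm_le_norm_of_mapsTo_ball hFd (hFm.mono_right ball_subset_closedBall) hF0
        (by simpa using hz)
    · have h1 := Complex.norm_le_norm_of_mapsTo_ball (z := F z) hKd
        (hKm.mono_right ball_subset_closedBall) hK0 (by simpa using hFm hz)
      have h2 : K (F z) = z := by
        simp only [K, F]
        rw [aux_mob_inv hb1 (by simpa using hmaps hz), hψl z hz]
      rwa [h2] at h1
  have hhalf : (1/2 : ℂ) ∈ ball (0:ℂ) 1 := by simp; norm_num
  obtain ⟨C, hC, hCF⟩ := Complex.affine_of_mapsTo_ball_of_exists_norm_dslope_eq_div' (R₂ := 1) hFd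
    (by rw [hF0]; exact hFm.mono_right ball_subset_closedBall)
    ⟨1/2, hhalf, by
      rw [dslope_of_ne _ (by norm_num), slope_def_field, hF0, sub_zero, sub_zero, norm_div,
        hFn _ hhalf]
      norm_num⟩
  have hC1 : ‖C‖ = 1 := by simpa using hC
  have hCC : C * starRingEnd ℂ C = 1 := by rw [Complex.mul_conj', hC1]; simp
  refine ⟨C, b * starRingEnd ℂ C, hC1, by simp [hC1], by simp [hC1, hb1], ?_⟩
  intro z hz
  have hzn : ‖φ z‖ < 1 := by simpa using hmaps hz
  have h1 := aux_mob_inv hb1 hzn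
  have h2 : auxMob 1 (-b) (φ z) = C * z := by
    have := hCF hz
    simp only [hF0] at this
    change F z = _
    rw [this]; simp [mul_comm]
  rw [h2] at h1
  rw [← h1, auxMob, auxMob]
  congr 1
  · linear_combination (-b) * hCC
  · simp; ring

lemma aux_tendsto_iter (k : ℕ) : ∀ {F : ℕ → ℂ → ℂ} {f : ℂ → ℂ} {U : Set ℂ}, IsOpen U →
    (∀ n, DifferentiableOn ℂ (F n) U) → TendstoLocallyUniformlyOn F f atTop U →
    ∀ z ∈ U, Tendsto (fun n => iteratedDeriv k (F n) z) atTop (nhds (iteratedDeriv k f z)) := by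
  induction k with
  | zero =>
    intro F f U hU hF h z hz
    simpa using h.tendsto_at hz
  | succ k ih =>
    intro F f U hU hF h z hz
    simp only [iteratedDeriv_succ']
    exact ih hU (fun n => (hF n).deriv hU) (h.deriv (Eventually.of_forall hF) hU) z hz

lemma aux_partial {f : ℂ → ℂ} (hf : MemS2 f) :
    TendstoLocallyUniformlyOn (fun N z => ∑ n ∈ Finset.range N, taylorCoeff f n * z ^ n) f atTop
      (ball 0 1) := by
  have hp : HasFPowerSeriesOnBall f (FormalMultilinearSeries.ofScalars ℂ (taylorCoeff f)) 0 1 := by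
    refine ⟨?_, one_pos, ?_⟩
    · apply ENNReal.le_of_forall_nnreal_lt
      intro r hr
      have hr1 : (r:ℝ) < 1 := by exact_mod_cast hr
      have hs := (hf.2.1 (r:ℂ) (by simpa using hr1)).summable.norm
      apply FormalMultilinearSeries.le_radius_of_summable
      refine hs.congr fun n => ?_
      simp
    · intro y hy
      have hy' : y ∈ ball (0:ℂ) 1 := by
        have h1 : ‖y‖₊ < 1 := by simpa [enorm_eq_nnnorm] using hy
        have h2 : ‖y‖ < 1 := by exact_mod_cast h1
        simpa using h2
      have := hf.2.1 y hy'
      simpa [FormalMultilinearSeries.ofScalars_apply_eq, mul_comm] using this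
  have h := hp.tendstoLocallyUniformlyOn'
  have e : eball (0:ℂ) 1 = ball 0 1 := by
    have := Metric.eball_coe (x := (0:ℂ)) (ε := 1)
    simpa using this
  rw [e] at h
  refine h.congr fun N z _ => ?_
  simp [FormalMultilinearSeries.partialSum, FormalMultilinearSeries.ofScalars_apply_eq, mul_comm]

theorem composition_deriv_h2_bound (φ f : ℂ → ℂ) (hφ : IsDiskAut φ) (hf : MemS2 f) :
    h2NormSq (deriv (fun z => f (φ z))) ≤
      ((1 + ‖φ 0‖) / (1 - ‖φ 0‖)) * s2NormSq f := by
  obtain ⟨μ, c, hμ, hcφ, hc, hform⟩ := aux_form hφ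
  have hmaps := hφ.2.mapsTo
  have hmm : Set.MapsTo (auxMob μ c) (ball 0 1) (ball 0 1) := fun z hz => by
    rw [← hform z hz]; exact hmaps hz
  have hmd := aux_mob_diff (μ := μ) hc
  have hconv := (aux_partial hf).comp (auxMob μ c) hmm hmd.continuousOn
  have hconv2 : TendstoLocallyUniformlyOn
      (fun N z => ∑ n ∈ Finset.range N, taylorCoeff f n * auxMob μ c z ^ n)
      (fun z => f (φ z)) atTop (ball 0 1) := by
    refine hconv.congr_right fun z hz => ?_
    simp [hform z hz]
  have hS : Summable (fun n : ℕ => ((n:ℝ)+1)^2 * ‖taylorCoeff f (n+1)‖^2) := by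
    have := (summable_nat_add_iff 1).2 hf.2.2
    simpa using this
  rw [← hcφ]
  have hC : 0 ≤ (1 + ‖c‖) / (1 - ‖c‖) :=
    div_nonneg (by positivity) (by linarith)
  apply Real.tsum_le_of_sum_range_le (fun n => by positivity)
  intro M
  have hlim : Tendsto (fun N => ∑ j ∈ Finset.range M, ‖taylorCoeff (deriv
      (fun z => ∑ n ∈ Finset.range (N+1), taylorCoeff f n * auxMob μ c z ^ n)) j‖^2) atTop
      (nhds (∑ j ∈ Finset.range M, ‖taylorCoeff (deriv (fun z => f (φ z))) j‖^2)) := by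
    apply tendsto_finsetSum
    intro j _
    apply Tendsto.pow
    apply Tendsto.norm
    unfold taylorCoeff
    apply Tendsto.div_const
    have := aux_tendsto_iter (j+1) isOpen_ball (fun N => by fun_prop) hconv2 0 (by simp)
    simp only [iteratedDeriv_succ'] at this
    exact (tendsto_add_atTop_iff_nat 1).2 this
  refine le_of_tendsto hlim (Eventually.of_forall fun N => ?_)
  refine (aux_poly hμ hc _ N M).trans ?_
  apply mul_le_mul_of_nonneg_left _ hC
  unfold s2NormSq
  have := hS.sum_le_tsum (Finset.range N) (fun n _ => by positivity)
  have h0 : 0 ≤ ‖taylorCoeff f 0‖^2 := by positivity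
  linarith
end
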